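/- Let k ≥ 2 be an even integer, q = exp(πi/k) and ζ = q² = exp(2πi/k). On C^{(Z/kZ)²}, with canonical basis indexed by pairs x = (x₁, x₂) ∈ (Z/kZ)², let R_a be the diagonal matrix with (x, x)-entry q^{x₁²}, let S be the matrix with (m, n)-entry k⁻¹·ζ^{−(m₁n₁ + m₂n₂)}, and set R_b = S³ R_a S. Then the braid relation R_a R_b R_a = R_b R_a R_b holds. -/

import Mathlib

noncomputable section

namespace Weil

open Complex

variable (k : ℕ) [NeZero k]

/-- `q = exp(πi/k)`. -/
def q : ℂ := Complex.exp (Real.pi * Complex.I / k)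

/-- `ζ = q² = exp(2πi/k)`. -/
def zeta : ℂ := q k ^ 2

/-- `R_a`: diagonal with entry `q^{x₁²}` at `x = (x₁, x₂)` (exponents computed via the
canonical integer lifts, which is unambiguous for even `k`). -/
def Ra : Matrix (ZMod k × ZMod k) (ZMod k × ZMod k) ℂ :=
  Matrix.diagonal fun x => q k ^ (x.1.val ^ 2)

/-- `R_c`: diagonal with entry `q^{(x₁+x₂)²}`. -/
def Rc : Matrix (ZMod k × ZMod k) (ZMod k × ZMod k) ℂ :=
  Matrix.diagonal fun x => q k ^ ((x.1.val + x.2.val) ^ 2)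

/-- `R_e`: diagonal with entry `q^{x₂²}`. -/
def Re : Matrix (ZMod k × ZMod k) (ZMod k × ZMod k) ℂ :=
  Matrix.diagonal fun x => q k ^ (x.2.val ^ 2)

/-- The `S`-matrix, with `(m, n)`-entry `k⁻¹ ζ^{-(m₁n₁ + m₂n₂)}`. -/
def Smat : Matrix (ZMod k × ZMod k) (ZMod k × ZMod k) ℂ := fun m n =>
  (k : ℂ)⁻¹ * zeta k ^ (-((m.1.val * n.1.val + m.2.val * n.2.val : ℕ) : ℤ))

/-- `R_b = S³ R_a S`. -/
def Rb : Matrix (ZMod k × ZMod k) (ZMod k × ZMod k) ℂ :=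
  Smat k ^ 3 * Ra k * Smat k

end Weil

namespace Weil

lemma q_ne_zero (k : ℕ) : q k ≠ 0 := Complex.exp_ne_zero _

lemma q_zpow (k : ℕ) (j : ℤ) : q k ^ j = Complex.exp (j * (Real.pi * Complex.I / k)) :=
  (Complex.exp_int_mul _ _).symm

lemma q_zpow_two_mul (k : ℕ) [NeZero k] (j : ℤ) :
    q k ^ (2 * j) = ZMod.stdAddChar (j : ZMod k) := by
  rw [ZMod.stdAddChar_coe, q_zpow]
  congr 1
  push_cast
  ring

lemma q_zpow_two_mul_self_mul (k : ℕ) [NeZero k] (j : ℤ) : q k ^ (2 * (k * j) : ℤ) = 1 := by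
  simp [q_zpow_two_mul]

lemma Smat_apply (k : ℕ) [NeZero k] (m n : ZMod k × ZMod k) :
    Smat k m n = (k : ℂ)⁻¹ * ZMod.stdAddChar (-(m.1 * n.1 + m.2 * n.2)) := by
  rw [Smat, zeta, ← zpow_natCast (q k) 2, ← zpow_mul, Nat.cast_ofNat, q_zpow_two_mul]
  simp

/-- The quadratic function `x ↦ q^{x²}` on `ZMod k`. -/
def quad (k : ℕ) (x : ZMod k) : ℂ := q k ^ (x.val ^ 2)

lemma Ra_eq_diagonal (k : ℕ) [NeZero k] : Ra k = Matrix.diagonal fun x => quad k x.1 := rfl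

lemma quad_ne_zero (k : ℕ) (x : ZMod k) : quad k x ≠ 0 := pow_ne_zero _ (q_ne_zero k)

lemma quad_intCast {k : ℕ} [NeZero k] (hke : Even k) (j : ℤ) :
    quad k (j : ZMod k) = q k ^ (j ^ 2) := by
  obtain ⟨r, hr⟩ := hke
  have hj : j ^ 2 = (((j : ZMod k).val ^ 2 : ℕ) : ℤ)
      + 2 * (k * ((j : ZMod k).val * (j / k) + r * (j / k) ^ 2)) := by
    have hk : (k : ℤ) = r + r := mod_cast hr
    have hdiv := Int.emod_add_mul_ediv j k
    rw [← ZMod.val_intCast] at hdiv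
    push_cast
    linear_combination (k : ℤ) * (j / k) ^ 2 * hk - (j + (j : ZMod k).val + k * (j / k)) * hdiv
  rw [hj, zpow_add₀ (q_ne_zero k), q_zpow_two_mul_self_mul, mul_one, zpow_natCast, quad]

lemma quad_add {k : ℕ} [NeZero k] (hke : Even k) (x y : ZMod k) :
    quad k (x + y) = quad k x * quad k y * ZMod.stdAddChar (x * y) := by
  obtain ⟨a, rfl⟩ := ZMod.intCast_surjective x
  obtain ⟨b, rfl⟩ := ZMod.intCast_surjective y
  rw [← Int.cast_add, ← Int.cast_mul, quad_intCast hke, quad_intCast hke, quad_intCast hke,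
    ← q_zpow_two_mul, ← zpow_add₀ (q_ne_zero k), ← zpow_add₀ (q_ne_zero k)]
  congr 1
  ring

lemma sum_stdAddChar_mul (k : ℕ) [NeZero k] (b : ZMod k) :
    ∑ x : ZMod k, (ZMod.stdAddChar (x * b) : ℂ) = if b = 0 then (k : ℂ) else 0 := by
  rw [AddChar.sum_mulShift b (ZMod.isPrimitive_stdAddChar k), ZMod.card]
  split_ifs <;> simp

/-- The quadratic Gauss sum `∑ q^{x²}`. -/
def gauss (k : ℕ) [NeZero k] : ℂ := ∑ x : ZMod k, quad k x

lemma sum_quad_mul_stdAddChar {k : ℕ} [NeZero k] (hke : Even k) (d : ZMod k) :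
    ∑ x : ZMod k, quad k x * ZMod.stdAddChar (x * d) = gauss k * (quad k d)⁻¹ := by
  rw [gauss, ← Equiv.sum_comp (Equiv.addRight d) (quad k), Finset.sum_mul]
  refine Finset.sum_congr rfl fun x _ => ?_
  rw [Equiv.coe_addRight, quad_add hke]
  field_simp [quad_ne_zero k d]

lemma gauss_mul_sum_inv {k : ℕ} [NeZero k] (hke : Even k) :
    gauss k * ∑ y : ZMod k, (quad k y)⁻¹ = k := by
  calc gauss k * ∑ y : ZMod k, (quad k y)⁻¹
      = ∑ y : ZMod k, ∑ x : ZMod k, quad k x * ZMod.stdAddChar (x * y) := by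
        rw [Finset.mul_sum]
        exact Finset.sum_congr rfl fun y _ => (sum_quad_mul_stdAddChar hke y).symm
    _ = ∑ x : ZMod k, quad k x * if x = 0 then (k : ℂ) else 0 := by
        rw [Finset.sum_comm]
        refine Finset.sum_congr rfl fun x _ => ?_
        rw [← Finset.mul_sum, ← sum_stdAddChar_mul]
        simp_rw [mul_comm x]
    _ = k := by simp [quad]

lemma sum_stdAddChar_prod (k : ℕ) [NeZero k] (a b : ZMod k) :
    ∑ x : ZMod k × ZMod k, (ZMod.stdAddChar (x.1 * a + x.2 * b) : ℂ)
      = if a = 0 ∧ b = 0 then (k : ℂ) ^ 2 else 0 := by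
  simp_rw [AddChar.map_add_eq_mul, Fintype.sum_prod_type, ← Finset.mul_sum, ← Finset.sum_mul,
    sum_stdAddChar_mul]
  split_ifs <;> simp_all [sq]

lemma Smat_sq_apply (k : ℕ) [NeZero k] (m n : ZMod k × ZMod k) :
    (Smat k * Smat k) m n = if m = -n then 1 else 0 := by
  have hk : (k : ℂ) ≠ 0 := NeZero.ne _
  have hterm (x : ZMod k × ZMod k) : Smat k m x * Smat k x n
      = ((k : ℂ) ^ 2)⁻¹ *
        ZMod.stdAddChar (x.1 * (-(m.1 + n.1)) + x.2 * (-(m.2 + n.2))) := by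
    rw [Smat_apply, Smat_apply, mul_mul_mul_comm, ← AddChar.map_add_eq_mul, ← mul_inv, ← sq]
    ring_nf
  rw [Matrix.mul_apply, Finset.sum_congr rfl fun x _ => hterm x, ← Finset.mul_sum,
    sum_stdAddChar_prod]
  simp only [neg_eq_zero, add_eq_zero_iff_eq_neg, Prod.ext_iff, Prod.fst_neg, Prod.snd_neg]
  split_ifs <;> simp [hk]

lemma Smat_cube_apply (k : ℕ) [NeZero k] (m n : ZMod k × ZMod k) :
    (Smat k ^ 3) m n = (k : ℂ)⁻¹ * ZMod.stdAddChar (m.1 * n.1 + m.2 * n.2) := by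
  rw [pow_succ', sq, Matrix.mul_apply]
  simp_rw [Smat_sq_apply, mul_ite, mul_one, mul_zero]
  rw [Finset.sum_ite_eq' Finset.univ (-n), if_pos (Finset.mem_univ _), Smat_apply]
  congr 2
  simp
  ring

lemma Rb_apply {k : ℕ} [NeZero k] (hke : Even k) (m n : ZMod k × ZMod k) :
    Rb k m n = if m.2 = n.2 then (k : ℂ)⁻¹ * gauss k * (quad k (m.1 - n.1))⁻¹ else 0 := by
  have hk : (k : ℂ) ≠ 0 := NeZero.ne _
  have hterm (x : ZMod k × ZMod k) : (Smat k ^ 3 * Ra k) m x * Smat k x n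
      = ((k : ℂ) ^ 2)⁻¹ * ((quad k x.1 * ZMod.stdAddChar (x.1 * (m.1 - n.1)))
        * ZMod.stdAddChar (x.2 * (m.2 - n.2))) := by
    rw [Ra_eq_diagonal, Matrix.mul_diagonal, Smat_cube_apply, Smat_apply, mul_assoc (quad k x.1),
      ← AddChar.map_add_eq_mul]
    have hchar : x.1 * (m.1 - n.1) + x.2 * (m.2 - n.2)
        = (m.1 * x.1 + m.2 * x.2) + -(x.1 * n.1 + x.2 * n.2) := by ring
    rw [hchar, AddChar.map_add_eq_mul _ (m.1 * x.1 + m.2 * x.2)]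
    ring
  rw [Rb, Matrix.mul_apply, Finset.sum_congr rfl fun x _ => hterm x, ← Finset.mul_sum,
    Fintype.sum_prod_type]
  simp_rw [← Finset.mul_sum, ← Finset.sum_mul, sum_stdAddChar_mul, sub_eq_zero,
    sum_quad_mul_stdAddChar hke]
  split_ifs
  · field_simp
  · simp

lemma Ra_mul_Rb_mul_Ra_apply {k : ℕ} [NeZero k] (hke : Even k) (m n : ZMod k × ZMod k) :
    (Ra k * Rb k * Ra k) m n
      = if m.2 = n.2 then (k : ℂ)⁻¹ * gauss k * ZMod.stdAddChar (m.1 * n.1) else 0 := by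
  have hquad : quad k m.1 * quad k n.1
      = ZMod.stdAddChar (m.1 * n.1) * quad k (m.1 - n.1) := by
    obtain ⟨a, ha⟩ := ZMod.intCast_surjective m.1
    obtain ⟨b, hb⟩ := ZMod.intCast_surjective n.1
    rw [← ha, ← hb]
    simp only [← Int.cast_sub, ← Int.cast_mul, quad_intCast hke, ← q_zpow_two_mul,
      ← zpow_add₀ (q_ne_zero k)]
    congr 1
    ring
  rw [Ra_eq_diagonal, Matrix.mul_diagonal, Matrix.diagonal_mul, Rb_apply hke]
  split_ifs
  · rw [mul_right_comm, hquad]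
    field_simp [quad_ne_zero k (m.1 - n.1)]
  · simp

lemma Rb_mul_Ra_mul_Rb_apply {k : ℕ} [NeZero k] (hke : Even k) (m n : ZMod k × ZMod k) :
    (Rb k * Ra k * Rb k) m n
      = if m.2 = n.2 then (k : ℂ)⁻¹ * gauss k * ZMod.stdAddChar (m.1 * n.1) else 0 := by
  have hk : (k : ℂ) ≠ 0 := NeZero.ne _
  have hquad (l : ZMod k) : (quad k (m.1 - l))⁻¹ * quad k l * (quad k (l - n.1))⁻¹
      = ZMod.stdAddChar (m.1 * n.1) * (quad k (l - (m.1 + n.1)))⁻¹ := by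
    have hprod : quad k l * quad k (l - (m.1 + n.1))
        = ZMod.stdAddChar (m.1 * n.1) * (quad k (m.1 - l) * quad k (l - n.1)) := by
      obtain ⟨a, ha⟩ := ZMod.intCast_surjective m.1
      obtain ⟨b, hb⟩ := ZMod.intCast_surjective n.1
      obtain ⟨c, rfl⟩ := ZMod.intCast_surjective l
      rw [← ha, ← hb]
      simp only [← Int.cast_add, ← Int.cast_sub, ← Int.cast_mul, quad_intCast hke,
        ← q_zpow_two_mul, ← zpow_add₀ (q_ne_zero k)]
      congr 1
      ring
    have h₁ := quad_ne_zero k (m.1 - l)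
    have h₂ := quad_ne_zero k (l - n.1)
    have h₃ := quad_ne_zero k (l - (m.1 + n.1))
    field_simp
    linear_combination hprod
  rw [Matrix.mul_apply, Fintype.sum_prod_type]
  simp_rw [Ra_eq_diagonal, Matrix.mul_diagonal, Rb_apply hke]
  simp only [ite_mul, zero_mul, Finset.sum_ite_eq, Finset.mem_univ, if_true]
  split_ifs with h
  · calc ∑ l : ZMod k, (k : ℂ)⁻¹ * gauss k * (quad k (m.1 - l))⁻¹ * quad k l
          * ((k : ℂ)⁻¹ * gauss k * (quad k (l - n.1))⁻¹)
        = ∑ l : ZMod k, ((k : ℂ)⁻¹ * gauss k) ^ 2 * ZMod.stdAddChar (m.1 * n.1)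
            * (quad k (l - (m.1 + n.1)))⁻¹ := by
          refine Finset.sum_congr rfl fun l _ => ?_
          linear_combination ((k : ℂ)⁻¹ * gauss k) ^ 2 * hquad l
      _ = ((k : ℂ)⁻¹ * gauss k) ^ 2 * ZMod.stdAddChar (m.1 * n.1)
            * ∑ y : ZMod k, (quad k y)⁻¹ := by
          rw [← Finset.mul_sum,
            ← Equiv.sum_comp (Equiv.subRight (m.1 + n.1)) fun y => (quad k y)⁻¹]
          rfl
      _ = (k : ℂ)⁻¹ * gauss k * ZMod.stdAddChar (m.1 * n.1) := by
          linear_combination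
            (k : ℂ)⁻¹ ^ 2 * gauss k * ZMod.stdAddChar (m.1 * n.1) * gauss_mul_sum_inv hke
              + (k : ℂ)⁻¹ * gauss k * ZMod.stdAddChar (m.1 * n.1) * inv_mul_cancel₀ hk
  · simp

end Weil

open Weil in
/-- **Theorem (Statement 16).** For even `k ≥ 2`, the braid relation
`R_a R_b R_a = R_b R_a R_b` holds, where `R_b = S³ R_a S`. -/
theorem braid_relation (k : ℕ) [NeZero k] (hk : 2 ≤ k) (hke : Even k) :
    Ra k * Rb k * Ra k = Rb k * Ra k * Rb k := by
  ext m n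
  rw [Ra_mul_Rb_mul_Ra_apply hke, Rb_mul_Ra_mul_Rb_apply hke]
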